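/- (Equation of motion for the linear friction Lagrangian.) Let a<b, m, γ > 0, U ∈ C²(ℝ;ℝ), and consider the Lagrangian L(q,v,v_l) = (1/2) m v² − U(q) + (γ/2) v_l² with fractional order α = 1/2. If q ∈ C²([a,b];ℝ) is an S_h-extremal of the functional I[q] = ∫_a^b [ (1/2) m q̇(t)² − U(q(t)) + (γ/2) (^C_aD_t^{1/2} q(t))² ] dt, then q satisfies m q̈(t) − γ _tD_b^{1/2}( ^C_aD_·^{1/2} q )(t) = −U'(q(t)) for all t ∈ [a,b]. -/

import Mathlib

open MeasureTheory intervalIntegral Real Filter Topology RealInnerProductSpace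

noncomputable section

/-- Left Riemann–Liouville fractional integral of order `β`:
`_aI_t^β f(t) = (1/Γ(β)) ∫_a^t (t−θ)^{β−1} f(θ) dθ`. -/
def leftRLint {E : Type*} [NormedAddCommGroup E] [NormedSpace ℝ E]
    (a β : ℝ) (f : ℝ → E) (t : ℝ) : E :=
  (Real.Gamma β)⁻¹ • ∫ θ in a..t, ((t - θ) ^ (β - 1) : ℝ) • f θ

/-- Right Riemann–Liouville fractional integral of order `β`:
`_tI_b^β f(t) = (1/Γ(β)) ∫_t^b (θ−t)^{β−1} f(θ) dθ`. -/
def rightRLint {E : Type*} [NormedAddCommGroup E] [NormedSpace ℝ E]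
    (b β : ℝ) (f : ℝ → E) (t : ℝ) : E :=
  (Real.Gamma β)⁻¹ • ∫ θ in t..b, ((θ - t) ^ (β - 1) : ℝ) • f θ

/-- Left Caputo fractional derivative of order `α`:
`^C_aD_t^α f(t) = (1/Γ(1−α)) ∫_a^t (t−θ)^{−α} f'(θ) dθ`. -/
def leftCaputo {E : Type*} [NormedAddCommGroup E] [NormedSpace ℝ E]
    (a α : ℝ) (f : ℝ → E) (t : ℝ) : E :=
  (Real.Gamma (1 - α))⁻¹ • ∫ θ in a..t, ((t - θ) ^ (-α) : ℝ) • deriv f θ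

/-- Right Riemann–Liouville fractional derivative of order `α`:
`_tD_b^α f(t) = −(d/dt) _tI_b^{1−α} f(t)`. -/
def rightRLderiv {E : Type*} [NormedAddCommGroup E] [NormedSpace ℝ E]
    (b α : ℝ) (f : ℝ → E) (t : ℝ) : E :=
  - deriv (fun s => rightRLint b (1 - α) f s) t

/-- The linear friction functional
`I[q] = ∫_a^b [ (1/2) m q̇² − U(q) + (γ/2) (^C_aD_t^{1/2} q)² ] dt`. -/
def frictionFunctional (a b m γ : ℝ) (U : ℝ → ℝ) (q : ℝ → ℝ) : ℝ :=
  ∫ t in a..b,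
    ((1 / 2) * m * (deriv q t) ^ 2 - U (q t)
      + (γ / 2) * (leftCaputo a (1 / 2) q t) ^ 2)

/-- `q` is an `S_h`-extremal of the linear friction functional. -/
def IsShExtremalFriction (a b m γ : ℝ) (U : ℝ → ℝ) (q : ℝ → ℝ) : Prop :=
  ∀ h : ℝ → ℝ, ContDiff ℝ 2 h → h a = 0 → h b = 0 →
    Tendsto
      (fun ε : ℝ =>
        (frictionFunctional a b m γ U (q + ε • h) - frictionFunctional a b m γ U q) / ε)
      (𝓝[≠] (0 : ℝ)) (𝓝 0)

/-- Regularised Abel kernel operator. -/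
def abelT (a : ℝ) (f : ℝ → ℝ) (t : ℝ) : ℝ :=
  2 * √(t - a) * ∫ u in (0:ℝ)..1, f (t - (t - a) * u ^ 2)

theorem rpow_neg_half_of_nonpos {x : ℝ} (hx : x ≤ 0) : x ^ (-(1/2) : ℝ) = 0 := by
  rcases hx.lt_or_eq with h | h
  · rw [Real.rpow_def_of_neg h]
    have : Real.cos (-(1/2) * π) = 0 := by
      rw [show -(1/2) * π = -(π/2) by ring, Real.cos_neg, Real.cos_pi_div_two]
    rw [this, mul_zero]
  · rw [h, Real.zero_rpow (by norm_num)]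

theorem rpow_neg_half {x : ℝ} : x ^ (-(1/2) : ℝ) = (√x)⁻¹ := by
  rcases le_or_gt x 0 with h | h
  · rw [rpow_neg_half_of_nonpos h, Real.sqrt_eq_zero_of_nonpos h, inv_zero]
  · rw [Real.rpow_neg h.le, Real.sqrt_eq_rpow]

theorem kernel_intervalIntegrable (t c d : ℝ) :
    IntervalIntegrable (fun θ : ℝ => (t - θ) ^ (-(1/2) : ℝ)) volume c d := by
  have := (intervalIntegral.intervalIntegrable_rpow' (a := t - c) (b := t - d)
    (r := (-(1/2) : ℝ)) (by norm_num)).comp_sub_left t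
  simpa using this

theorem kernel_mul_intervalIntegrable {f : ℝ → ℝ} (hf : Continuous f) (t c d : ℝ) :
    IntervalIntegrable (fun θ : ℝ => (t - θ) ^ (-(1/2) : ℝ) * f θ) volume c d :=
  (kernel_intervalIntegrable t c d).mul_continuousOn hf.continuousOn

theorem left_eq_abelT {f : ℝ → ℝ} (hf : Continuous f) (a t : ℝ) :
    ∫ θ in a..t, (t - θ) ^ (-(1/2) : ℝ) * f θ = abelT a f t := by
  rcases le_or_gt t a with h | h
  · rw [abelT, Real.sqrt_eq_zero_of_nonpos (by linarith), mul_zero, zero_mul]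
    rw [intervalIntegral.integral_symm, neg_eq_zero]
    apply intervalIntegral.integral_zero_ae
    refine ae_of_all _ fun x hx => ?_
    rw [Set.uIoc_of_le h] at hx
    rw [rpow_neg_half_of_nonpos (by linarith [hx.1]), zero_mul]
  · have hta : 0 < t - a := by linarith
    have hs : 0 < √(t - a) := Real.sqrt_pos.2 hta
    have e : ∀ u ∈ Set.Ioc (0:ℝ) 1, ((fun θ => (t - θ) ^ (-(1/2) : ℝ) * f θ) ∘
        fun u : ℝ => t - (t - a) * u ^ 2) u * -((t - a) * (2 * u))
        = ((-2) * √(t - a)) * f (t - (t - a) * u ^ 2) := by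
      intro u hu
      simp only [Function.comp]
      rw [rpow_neg_half, sub_sub_cancel, Real.sqrt_mul hta.le, Real.sqrt_sq hu.1.le]
      have hsq : √(t - a) ^ 2 = t - a := Real.sq_sqrt hta.le
      have hu0 := hu.1.ne'
      generalize f (t - (t - a) * u ^ 2) = A
      generalize √(t - a) = r at *
      rw [← hsq]
      field_simp
    have key := intervalIntegral.integral_comp_mul_deriv''' (a := 0) (b := 1)
      (f := fun u : ℝ => t - (t - a) * u ^ 2) (f' := fun u => -((t - a) * (2 * u)))
      (g := fun θ => (t - θ) ^ (-(1/2) : ℝ) * f θ) (by fun_prop) ?_ ?_ ?_ ?_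
    · rw [intervalIntegral.integral_congr_ae (g := fun u => ((-2) * √(t - a)) * f (t - (t - a) * u ^ 2))
        (ae_of_all _ fun u hu => e u (by rwa [Set.uIoc_of_le zero_le_one] at hu)),
        intervalIntegral.integral_const_mul] at key
      simp only [one_pow, mul_one, sub_sub_cancel, ne_eq, OfNat.ofNat_ne_zero, not_false_eq_true,
        zero_pow, mul_zero, sub_zero] at key
      rw [intervalIntegral.integral_symm, ← key, abelT]
      ring
    · intro x hx
      apply HasDerivAt.hasDerivWithinAt
      have := ((hasDerivAt_pow 2 x).const_mul (t - a)).const_sub t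
      simpa using this
    · rintro _ ⟨u, hu, rfl⟩
      simp at hu
      have : 0 < t - (t - (t - a) * u ^ 2) := by
        have := mul_pos hta (pow_pos hu.1 2); linarith
      apply ContinuousAt.continuousWithinAt
      refine ContinuousAt.mul (ContinuousAt.rpow_const (by fun_prop) (Or.inl this.ne')) hf.continuousAt
    · have : (fun u : ℝ => t - (t - a) * u ^ 2) '' Set.uIcc 0 1 ⊆ Set.uIcc a t := by
        rintro _ ⟨u, hu, rfl⟩
        rw [Set.uIcc_of_le zero_le_one] at hu
        rw [Set.uIcc_of_le h.le]
        have : u ^ 2 ≤ 1 := pow_le_one₀ hu.1 hu.2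
        constructor
        · simp only; nlinarith
        · simp only; nlinarith [sq_nonneg u]
      refine IntegrableOn.mono_set ?_ this
      have := kernel_mul_intervalIntegrable hf t a t
      rw [Set.uIcc_of_le h.le]
      exact (intervalIntegrable_iff_integrableOn_Icc_of_le h.le).1 this
    · rw [Set.uIcc_of_le zero_le_one, integrableOn_Icc_iff_integrableOn_Ioc]
      refine IntegrableOn.congr_fun (f := fun u => ((-2) * √(t - a)) * f (t - (t - a) * u ^ 2)) ?_
        (fun u hu => (e u hu).symm) measurableSet_Ioc
      exact (Continuous.integrableOn_Icc (by fun_prop)).mono_set Set.Ioc_subset_Icc_self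

theorem right_eq_abelT {f : ℝ → ℝ} (hf : Continuous f) (b s : ℝ) :
    ∫ θ in s..b, (θ - s) ^ (-(1/2) : ℝ) * f θ = abelT (-b) (fun x => f (-x)) (-s) := by
  rw [← left_eq_abelT (by fun_prop)]
  have := intervalIntegral.integral_comp_neg (a := -b) (b := -s)
    (fun θ => (θ - s) ^ (-(1/2) : ℝ) * f θ)
  rw [neg_neg, neg_neg] at this
  rw [← this]
  congr 1; ext x; congr 2; ring

theorem continuous_abelT {f : ℝ → ℝ} (hf : Continuous f) (a : ℝ) : Continuous (abelT a f) := by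
  unfold abelT
  refine Continuous.mul (by fun_prop) ?_
  apply intervalIntegral.continuous_parametric_intervalIntegral_of_continuous'
  unfold Function.uncurry
  fun_prop

theorem hasDerivAt_param {F F' : ℝ → ℝ → ℝ} (hF : ∀ x, Continuous (F x))
    (hF' : Continuous (Function.uncurry F'))
    (hd : ∀ x t, HasDerivAt (fun y => F y t) (F' x t) x) (c d x₀ : ℝ) :
    HasDerivAt (fun x => ∫ t in c..d, F x t) (∫ t in c..d, F' x₀ t) x₀ := by
  obtain ⟨C, hC⟩ := ((isCompact_closedBall x₀ 1).prod (isCompact_uIcc (a := c) (b := d))).exists_bound_of_continuousOn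
    hF'.continuousOn
  refine (intervalIntegral.hasDerivAt_integral_of_dominated_loc_of_deriv_le (bound := fun _ => C)
    (F' := F') (Metric.closedBall_mem_nhds x₀ one_pos) ?_ ?_ ?_ ?_ ?_ ?_).2
  · exact Eventually.of_forall fun x => (hF x).aestronglyMeasurable
  · exact (hF x₀).intervalIntegrable _ _
  · exact (hF'.comp (Continuous.prodMk_right x₀)).aestronglyMeasurable
  · exact ae_of_all _ fun t ht x hx => hC (x, t) ⟨hx, Set.uIoc_subset_uIcc ht⟩
  · exact intervalIntegrable_const
  · exact ae_of_all _ fun t ht x hx => hd x t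

/-- derivative of the averaged integral -/
theorem hasDerivAt_avg {f f' : ℝ → ℝ} (hf : ∀ x, HasDerivAt f (f' x) x) (hf' : Continuous f')
    (a t : ℝ) :
    HasDerivAt (fun t => ∫ u in (0:ℝ)..1, f (t - (t - a) * u ^ 2))
      (∫ u in (0:ℝ)..1, f' (t - (t - a) * u ^ 2) * (1 - u ^ 2)) t := by
  have hc : Continuous f := continuous_iff_continuousAt.2 fun x => (hf x).continuousAt
  apply hasDerivAt_param (F := fun t u => f (t - (t - a) * u ^ 2))
    (F' := fun t u => f' (t - (t - a) * u ^ 2) * (1 - u ^ 2))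
  · intro x; fun_prop
  · unfold Function.uncurry; fun_prop
  · intro x u
    have h1 : HasDerivAt (fun y : ℝ => y - (y - a) * u ^ 2) (1 - u ^ 2) x := by
      have := HasDerivAt.fun_sub (hasDerivAt_id x) (((hasDerivAt_id x).sub_const a).mul_const (u ^ 2))
      simpa using this
    exact (hf _).comp x h1

theorem hasDerivAt_abelT {f f' : ℝ → ℝ} (hf : ∀ x, HasDerivAt f (f' x) x) (hf' : Continuous f')
    {a t : ℝ} (hat : a < t) :
    HasDerivAt (abelT a f) (f a / √(t - a) + abelT a f' t) t := by
  have hc : Continuous f := continuous_iff_continuousAt.2 fun x => (hf x).continuousAt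
  have hta : 0 < t - a := by linarith
  have hs : 0 < √(t - a) := Real.sqrt_pos.2 hta
  have h1 : HasDerivAt (fun t => 2 * √(t - a)) (2 * (1 / (2 * √(t - a)))) t := by
    have := (((hasDerivAt_id t).sub_const a).sqrt hta.ne').const_mul 2
    simpa using this
  have h2 := h1.mul (hasDerivAt_avg hf hf' a t)
  refine h2.congr_deriv ?_
  have ibp : ∫ u in (0:ℝ)..1, f (t - (t - a) * u ^ 2) =
      f a + 2 * (t - a) * ∫ u in (0:ℝ)..1, f' (t - (t - a) * u ^ 2) * u ^ 2 := by
    have hd : ∀ u ∈ Set.uIcc (0:ℝ) 1, HasDerivAt (fun u => u * f (t - (t - a) * u ^ 2))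
        (f (t - (t - a) * u ^ 2) - 2 * (t - a) * (f' (t - (t - a) * u ^ 2) * u ^ 2)) u := by
      intro u _
      have h3 : HasDerivAt (fun u : ℝ => t - (t - a) * u ^ 2) (-((t - a) * (2 * u))) u := by
        have := ((hasDerivAt_pow 2 u).const_mul (t - a)).const_sub t
        simpa using this
      refine ((hasDerivAt_id u).mul ((hf _).comp u h3)).congr_deriv ?_
      simp; ring
    have := intervalIntegral.integral_eq_sub_of_hasDerivAt hd
      (Continuous.intervalIntegrable (by fun_prop) _ _)
    rw [intervalIntegral.integral_sub (Continuous.intervalIntegrable (by fun_prop) _ _)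
      (Continuous.intervalIntegrable (by fun_prop) _ _), intervalIntegral.integral_const_mul] at this
    simp at this
    linarith
  have e2 : ∫ u in (0:ℝ)..1, f' (t - (t - a) * u ^ 2) * (1 - u ^ 2) =
      (∫ u in (0:ℝ)..1, f' (t - (t - a) * u ^ 2)) - ∫ u in (0:ℝ)..1, f' (t - (t - a) * u ^ 2) * u ^ 2 := by
    rw [← intervalIntegral.integral_sub (Continuous.intervalIntegrable (by fun_prop) _ _)
      (Continuous.intervalIntegrable (by fun_prop) _ _)]
    congr 1; ext u; ring
  rw [ibp, e2, abelT]
  have hsq : √(t - a) ^ 2 = t - a := Real.sq_sqrt hta.le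
  generalize (∫ u in (0:ℝ)..1, f' (t - (t - a) * u ^ 2) * u ^ 2) = A
  generalize (∫ u in (0:ℝ)..1, f' (t - (t - a) * u ^ 2)) = B
  generalize √(t - a) = r at *
  rw [← hsq]
  field_simp
  ring

theorem hasDerivAt_abelT_of_zero {f f' : ℝ → ℝ} (hf : ∀ x, HasDerivAt f (f' x) x)
    (hf' : Continuous f') {a : ℝ} (h0 : f a = 0) (t : ℝ) :
    HasDerivAt (abelT a f) (abelT a f' t) t := by
  have hc : Continuous f := continuous_iff_continuousAt.2 fun x => (hf x).continuousAt
  refine hasDerivAt_of_hasDerivAt_of_ne' (x := a) ?_ (continuous_abelT hc a).continuousAt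
    (continuous_abelT hf' a).continuousAt t
  intro y hy
  rcases lt_or_gt_of_ne hy with h | h
  · have z : ∀ g : ℝ → ℝ, ∀ x, x < a → abelT a g x = 0 := by
      intro g x hx
      rw [abelT, Real.sqrt_eq_zero_of_nonpos (by linarith), mul_zero, zero_mul]
    rw [z _ _ h]
    refine (hasDerivAt_const y (0:ℝ)).congr_of_eventuallyEq ?_
    filter_upwards [eventually_lt_nhds h] with x hx using z _ _ hx
  · have := hasDerivAt_abelT hf hf' h
    rwa [h0, zero_div, zero_add] at this
theorem kernel_integrableOn_square {a b : ℝ} (hab : a < b) :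
    IntegrableOn (fun p : ℝ × ℝ => (p.1 - p.2) ^ (-(1/2) : ℝ)) (Set.Icc a b ×ˢ Set.Icc a b) := by
  have h1 : Integrable ((Set.Icc a b).indicator (fun _ => (1:ℝ))) volume :=
    (integrable_indicator_iff measurableSet_Icc).2 (Continuous.integrableOn_Icc (by fun_prop))
  have h2 : Integrable ((Set.Icc (a - b) (b - a)).indicator (fun x : ℝ => x ^ (-(1/2) : ℝ))) volume := by
    refine (integrable_indicator_iff measurableSet_Icc).2 ?_
    exact (intervalIntegrable_iff_integrableOn_Icc_of_le (by linarith)).1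
      (intervalIntegral.intervalIntegrable_rpow' (by norm_num))
  have h3 := (h1.convolution_integrand (ContinuousLinearMap.mul ℝ ℝ) h2).integrableOn
    (s := Set.Icc a b ×ˢ Set.Icc a b)
  refine IntegrableOn.congr_fun h3 ?_ (measurableSet_Icc.prod measurableSet_Icc)
  rintro ⟨x, y⟩ ⟨hx, hy⟩
  have hm : x - y ∈ Set.Icc (a - b) (b - a) := ⟨by linarith [hx.1, hy.2], by linarith [hx.2, hy.1]⟩
  simp only [ContinuousLinearMap.mul_apply']
  rw [Set.indicator_of_mem hy, Set.indicator_of_mem hm, one_mul]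

theorem abelT_fubini {a b : ℝ} (hab : a < b) {f g : ℝ → ℝ} (hf : Continuous f) (hg : Continuous g) :
    ∫ t in a..b, f t * abelT a g t
      = ∫ θ in a..b, abelT (-b) (fun x => f (-x)) (-θ) * g θ := by
  have hI : IntegrableOn (Function.uncurry fun t θ : ℝ => (t - θ) ^ (-(1/2) : ℝ) * (f t * g θ))
      (Set.uIoc a b ×ˢ Set.uIoc a b) := by
    have : IntegrableOn (fun p : ℝ × ℝ => (p.1 - p.2) ^ (-(1/2) : ℝ) * (f p.1 * g p.2))
        (Set.Icc a b ×ˢ Set.Icc a b) :=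
      (kernel_integrableOn_square hab).mul_continuousOn (by fun_prop) (isCompact_Icc.prod isCompact_Icc)
    rw [Set.uIoc_of_le hab.le]
    exact this.mono_set (Set.prod_mono Set.Ioc_subset_Icc_self Set.Ioc_subset_Icc_self)
  have hsw := intervalIntegral_intervalIntegral_swap hI
  have e1 : ∀ t ∈ Set.uIcc a b, f t * abelT a g t
      = ∫ θ in a..b, (t - θ) ^ (-(1/2) : ℝ) * (f t * g θ) := by
    intro t ht
    rw [Set.uIcc_of_le hab.le] at ht
    have hc : Continuous fun θ => f t * g θ := by fun_prop
    rw [← intervalIntegral.integral_add_adjacent_intervals (b := t)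
      (kernel_mul_intervalIntegrable hc _ _ _) (kernel_mul_intervalIntegrable hc _ _ _)]
    have z : ∫ θ in t..b, (t - θ) ^ (-(1/2) : ℝ) * (f t * g θ) = 0 := by
      apply intervalIntegral.integral_zero_ae
      refine ae_of_all _ fun x hx => ?_
      rw [Set.uIoc_of_le ht.2] at hx
      rw [rpow_neg_half_of_nonpos (by linarith [hx.1]), zero_mul]
    rw [z, add_zero, ← left_eq_abelT hg, ← intervalIntegral.integral_const_mul]
    congr 1; ext x; ring
  have e2 : ∀ θ ∈ Set.uIcc a b, abelT (-b) (fun x => f (-x)) (-θ) * g θ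
      = ∫ t in a..b, (t - θ) ^ (-(1/2) : ℝ) * (f t * g θ) := by
    intro θ hθ
    rw [Set.uIcc_of_le hab.le] at hθ
    have hi : ∀ c d, IntervalIntegrable (fun t => (t - θ) ^ (-(1/2) : ℝ) * (f t * g θ)) volume c d := by
      intro c d
      have := (intervalIntegral.intervalIntegrable_rpow' (a := c - θ) (b := d - θ)
        (r := (-(1/2) : ℝ)) (by norm_num)).comp_sub_right θ
      simp only [sub_add_cancel] at this
      exact this.mul_continuousOn (by fun_prop)
    rw [← intervalIntegral.integral_add_adjacent_intervals (b := θ) (hi _ _) (hi _ _)]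
    have z : ∫ t in a..θ, (t - θ) ^ (-(1/2) : ℝ) * (f t * g θ) = 0 := by
      apply intervalIntegral.integral_zero_ae
      refine ae_of_all _ fun x hx => ?_
      rw [Set.uIoc_of_le hθ.1] at hx
      rw [rpow_neg_half_of_nonpos (by linarith [hx.2]), zero_mul]
    rw [z, zero_add, ← right_eq_abelT hf, ← intervalIntegral.integral_mul_const]
    congr 1; ext x; ring
  rw [intervalIntegral.integral_congr e1, intervalIntegral.integral_congr e2, hsw]

theorem dubois {a b : ℝ} (hab : a < b) {G : ℝ → ℝ} (hG : Continuous G)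
    (H : ∀ h : ℝ → ℝ, ContDiff ℝ 2 h → h a = 0 → h b = 0 → ∫ t in a..b, G t * deriv h t = 0) :
    ∃ C, ∀ t ∈ Set.Icc a b, G t = C := by
  have hba : b - a ≠ 0 := by linarith
  refine ⟨(∫ t in a..b, G t) / (b - a), ?_⟩
  set C := (∫ t in a..b, G t) / (b - a) with hC
  have hcont : Continuous fun t => G t - C := by fun_prop
  have key := IsOpen.ae_eq_zero_of_integral_contDiff_smul_eq_zero (μ := volume) (isOpen_Ioo (a := a) (b := b))
    (f := fun t => G t - C) (hcont.locallyIntegrable.locallyIntegrableOn _) ?_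
  · have hae : (fun t => G t) =ᵐ[volume.restrict (Set.Icc a b)] fun _ => C := by
      rw [← restrict_Ioo_eq_restrict_Icc]
      refine (ae_restrict_iff' measurableSet_Ioo).2 ?_
      filter_upwards [key] with x hx hx' using by linarith [hx hx']
    intro t ht
    exact Measure.eqOn_Icc_of_ae_eq volume hab.ne hae hG.continuousOn continuousOn_const ht
  · intro φ hφ hcs hsupp
    have hφc : Continuous φ := hφ.continuous
    have e0 : ∫ x, φ x • (G x - C) = ∫ x in a..b, φ x * (G x - C) := by
      rw [intervalIntegral.integral_of_le hab.le]
      symm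
      apply setIntegral_eq_integral_of_forall_compl_eq_zero
      intro x hx
      have : φ x = 0 := by
        by_contra hne
        exact hx (Set.Ioo_subset_Ioc_self (hsupp (subset_tsupport _ hne)))
      rw [this, zero_mul]
    rw [e0]
    set κ := (∫ t in a..b, φ t) / (b - a) with hκ
    have hd : ∀ x, HasDerivAt (fun t => ∫ u in a..t, (φ u - κ)) (φ x - κ) x := fun x =>
      intervalIntegral.integral_hasDerivAt_right
        (Continuous.intervalIntegrable (by fun_prop) _ _)
        (Continuous.stronglyMeasurableAtFilter (by fun_prop) _ _) (by fun_prop)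
    have hder : deriv (fun t => ∫ u in a..t, (φ u - κ)) = fun x => φ x - κ :=
      funext fun x => (hd x).deriv
    have := H (fun t => ∫ u in a..t, (φ u - κ)) ?_ (by simp) ?_
    · rw [hder] at this
      have i1 : ∫ t in a..b, G t * (φ t - κ) = (∫ t in a..b, φ t * G t) - κ * ∫ t in a..b, G t := by
        rw [← intervalIntegral.integral_const_mul, ← intervalIntegral.integral_sub
          (Continuous.intervalIntegrable (by fun_prop) _ _)
          (Continuous.intervalIntegrable (by fun_prop) _ _)]
        congr 1; ext t; ring
      have i2 : ∫ t in a..b, φ t * (G t - C) = (∫ t in a..b, φ t * G t) - C * ∫ t in a..b, φ t := by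
        rw [← intervalIntegral.integral_const_mul, ← intervalIntegral.integral_sub
          (Continuous.intervalIntegrable (by fun_prop) _ _)
          (Continuous.intervalIntegrable (by fun_prop) _ _)]
        congr 1; ext t; ring
      rw [i2]; rw [i1] at this
      rw [← this, hC, hκ]; ring
    · have : ContDiff ℝ (1 + 1) (fun t => ∫ u in a..t, (φ u - κ)) := by
        rw [contDiff_succ_iff_deriv]
        refine ⟨fun x => (hd x).differentiableAt, by simp, ?_⟩
        rw [hder]
        exact (hφ.of_le (by exact_mod_cast le_top)).sub contDiff_const
      exact this
    · rw [intervalIntegral.integral_sub (hφc.intervalIntegrable _ _) (by simp)]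
      simp [hκ]; field_simp; ring

theorem no_deriv_abel {a b : ℝ} (hab : a < b) {S : ℝ → ℝ} {d : ℝ} (hS : HasDerivAt S d a)
    (h : ∀ s ∈ Set.Icc a b, abelT (-b) (fun x => √(-x - a)) (-s) = S s) : False := by
  have form : ∀ s ∈ Set.Ioo a b, abelT (-b) (fun x => √(-x - a)) (-s)
      = √(b - s) * √(b - a) + (s - a) * Real.arsinh (√(b - s) / √(s - a)) := by
    intro s hs
    have hx : 0 < s - a := by linarith [hs.1]
    have hr : 0 < b - s := by linarith [hs.2]
    have hrs := Real.sq_sqrt hr.le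
    have hxs := Real.sq_sqrt hx.le
    have hxp := Real.sqrt_pos.2 hx
    have hd : ∀ u ∈ Set.uIcc (0:ℝ) 1, HasDerivAt
        (fun u => √(b - s) * u * √((s - a) + (b - s) * u ^ 2)
          + (s - a) * Real.arsinh (√(b - s) * u / √(s - a)))
        (2 * √(b - s) * √((s - a) + (b - s) * u ^ 2)) u := by
      intro u _
      have hp : 0 < (s - a) + (b - s) * u ^ 2 := by positivity
      have hps := Real.sq_sqrt hp.le
      have hpp := Real.sqrt_pos.2 hp
      have h1 : HasDerivAt (fun u : ℝ => (s - a) + (b - s) * u ^ 2) ((b - s) * (2 * u)) u := by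
        have := ((hasDerivAt_pow 2 u).const_mul (b - s)).const_add (s - a)
        simpa using this
      have h2 : HasDerivAt (fun u : ℝ => √(b - s) * u) (√(b - s)) u := by
        simpa using (hasDerivAt_id u).const_mul √(b - s)
      have h3 := (h2.div_const √(s - a)).arsinh.const_mul (s - a)
      refine ((h2.mul (h1.sqrt hp.ne')).add h3).congr_deriv ?_
      have e : √(1 + (√(b - s) * u / √(s - a)) ^ 2) = √((s - a) + (b - s) * u ^ 2) / √(s - a) := by
        rw [← Real.sqrt_div' _ hx.le]
        congr 1
        rw [div_pow, mul_pow, hrs, hxs]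
        field_simp
      rw [e]
      simp only [smul_eq_mul]
      generalize √((s - a) + (b - s) * u ^ 2) = P at *
      generalize √(b - s) = r at *
      generalize √(s - a) = y at *
      rw [← hrs, ← hxs]
      rw [← hrs, ← hxs] at hps
      field_simp
      linear_combination (-r) * hps
    have := intervalIntegral.integral_eq_sub_of_hasDerivAt hd
      (Continuous.intervalIntegrable (by fun_prop) _ _)
    rw [intervalIntegral.integral_const_mul] at this
    simp only [one_pow, mul_one, mul_zero, zero_mul, zero_div, Real.arsinh_zero, add_zero, sub_zero] at this
    rw [abelT, show s - a + (b - s) = b - a by ring] at *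
    rw [← this]
    have e1 : -s - -b = b - s := by ring
    rw [e1]
    congr 2; ext u; congr 1; ring
  have form0 : abelT (-b) (fun x => √(-x - a)) (-a) = b - a := by
    have hr : 0 < b - a := by linarith
    have hrs := Real.sq_sqrt hr.le
    rw [abelT]
    have e : ∀ u ∈ Set.uIcc (0:ℝ) 1, √(-(-a - (-a - -b) * u ^ 2) - a) = √(b - a) * u := by
      intro u hu
      rw [Set.uIcc_of_le zero_le_one] at hu
      rw [show -(-a - (-a - -b) * u ^ 2) - a = (b - a) * u ^ 2 by ring, Real.sqrt_mul hr.le,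
        Real.sqrt_sq hu.1]
    rw [intervalIntegral.integral_congr e, intervalIntegral.integral_const_mul, integral_id,
      show -a - -b = b - a by ring]
    linear_combination hrs
  have hsl : ∀ᶠ s in 𝓝[>] a, slope S a s < d + 1 := by
    have := (hasDerivAt_iff_tendsto_slope.1 hS).mono_left
      (nhdsWithin_mono a (fun x (hx : a < x) => hx.ne' : Set.Ioi a ⊆ {a}ᶜ))
    exact this.eventually (eventually_lt_nhds (by linarith))
  have hev : ∀ᶠ s in 𝓝[>] a, b - s ≤ Real.sinh (d + 2) ^ 2 * (s - a) := by
    filter_upwards [hsl, Ioo_mem_nhdsGT hab] with s h1 hs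
    have hx : 0 < s - a := by linarith [hs.1]
    have hr : 0 < b - s := by linarith [hs.2]
    have hba : 0 < b - a := by linarith
    rw [slope_def_field, ← h s ⟨hs.1.le, hs.2.le⟩, ← h a ⟨le_rfl, hab.le⟩, form s hs, form0,
      div_lt_iff₀ hx] at h1
    have h2 : b - s ≤ √(b - s) * √(b - a) := by
      calc b - s = √(b - s) * √(b - s) := (Real.mul_self_sqrt hr.le).symm
        _ ≤ _ := by gcongr; exact hs.1.le
    have h3 : Real.arsinh (√(b - s) / √(s - a)) < d + 2 := by
      by_contra hcon
      push Not at hcon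
      nlinarith
    have h4 : √(b - s) / √(s - a) < Real.sinh (d + 2) := by
      rw [← Real.sinh_arsinh (√(b - s) / √(s - a))]
      exact Real.sinh_lt_sinh.2 h3
    have h5 : (√(b - s) / √(s - a)) ^ 2 ≤ Real.sinh (d + 2) ^ 2 :=
      pow_le_pow_left₀ (by positivity) h4.le 2
    rw [div_pow, Real.sq_sqrt hr.le, Real.sq_sqrt hx.le, div_le_iff₀ hx] at h5
    exact h5
  have l1 : Tendsto (fun s => b - s) (𝓝[>] a) (𝓝 (b - a)) :=
    (Continuous.tendsto (by fun_prop) a).mono_left nhdsWithin_le_nhds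
  have l2 : Tendsto (fun s => Real.sinh (d + 2) ^ 2 * (s - a)) (𝓝[>] a) (𝓝 (Real.sinh (d + 2) ^ 2 * (a - a))) :=
    (Continuous.tendsto (by fun_prop) a).mono_left nhdsWithin_le_nhds
  have := le_of_tendsto_of_tendsto l1 l2 hev
  rw [sub_self, mul_zero] at this
  linarith
theorem caputo_eq {q : ℝ → ℝ} (hq : Continuous (deriv q)) (a t : ℝ) :
    leftCaputo a (1 / 2) q t = (Real.Gamma (1 / 2))⁻¹ * abelT a (deriv q) t := by
  rw [leftCaputo, ← left_eq_abelT hq]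
  norm_num

theorem rightRL_eq {f : ℝ → ℝ} (hf : Continuous f) (b s : ℝ) :
    rightRLint b (1 - 1 / 2) f s
      = (Real.Gamma (1 / 2))⁻¹ * abelT (-b) (fun x => f (-x)) (-s) := by
  rw [rightRLint, ← right_eq_abelT hf]
  norm_num

theorem abelT_add_mul {f g : ℝ → ℝ} (hf : Continuous f) (hg : Continuous g) (ε a t : ℝ) :
    abelT a (fun x => f x + ε * g x) t = abelT a f t + ε * abelT a g t := by
  unfold abelT
  rw [intervalIntegral.integral_add (Continuous.intervalIntegrable (by fun_prop) _ _)
    (Continuous.intervalIntegrable (by fun_prop) _ _), intervalIntegral.integral_const_mul]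
  ring

theorem first_variation {a b m γ : ℝ} {U q h : ℝ → ℝ} (hU : ContDiff ℝ 2 U) (hq : ContDiff ℝ 2 q)
    (hh : ContDiff ℝ 2 h)
    (hlim : Tendsto (fun ε : ℝ =>
        (frictionFunctional a b m γ U (q + ε • h) - frictionFunctional a b m γ U q) / ε)
      (𝓝[≠] (0 : ℝ)) (𝓝 0)) :
    ∫ t in a..b, (m * deriv q t * deriv h t - deriv U (q t) * h t
      + γ * (leftCaputo a (1 / 2) q t * leftCaputo a (1 / 2) h t)) = 0 := by
  have hq' : Continuous (deriv q) := hq.continuous_deriv (by norm_num)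
  have hh' : Continuous (deriv h) := hh.continuous_deriv (by norm_num)
  have hU' : Continuous (deriv U) := hU.continuous_deriv (by norm_num)
  have hqc := hq.continuous
  have hhc := hh.continuous
  have hUc := hU.continuous
  have hqd : Differentiable ℝ q := hq.differentiable (by norm_num)
  have hhd : Differentiable ℝ h := hh.differentiable (by norm_num)
  have hUd : Differentiable ℝ U := hU.differentiable (by norm_num)
  have hder : ∀ ε : ℝ, deriv (q + ε • h) = fun x => deriv q x + ε * deriv h x := by
    intro ε; ext x
    exact ((hqd x).hasDerivAt.add ((hhd x).hasDerivAt.const_smul ε)).deriv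
  have hKc : ∀ f : ℝ → ℝ, Continuous (deriv f) → Continuous (leftCaputo a (1/2) f) := by
    intro f hf
    rw [show leftCaputo a (1/2) f = fun t => (Real.Gamma (1 / 2))⁻¹ * abelT a (deriv f) t from
      funext (caputo_eq hf a)]
    exact continuous_const.mul (continuous_abelT hf a)
  have hcap : ∀ ε t, leftCaputo a (1/2) (q + ε • h) t
      = leftCaputo a (1/2) q t + ε * leftCaputo a (1/2) h t := by
    intro ε t
    rw [caputo_eq (by rw [hder]; fun_prop), caputo_eq hq', caputo_eq hh', hder,
      abelT_add_mul hq' hh']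
    ring
  have cq := hKc q hq'
  have ch := hKc h hh'
  have hF : ∀ ε, frictionFunctional a b m γ U (q + ε • h) = ∫ t in a..b,
      ((1 / 2) * m * (deriv q t + ε * deriv h t) ^ 2 - U (q t + ε * h t)
      + (γ / 2) * (leftCaputo a (1 / 2) q t + ε * leftCaputo a (1/2) h t) ^ 2) := by
    intro ε
    unfold frictionFunctional
    simp only [hcap, hder, Pi.add_apply, Pi.smul_apply, smul_eq_mul]
  have hD := hasDerivAt_param (F := fun ε t =>
      ((1 / 2) * m * (deriv q t + ε * deriv h t) ^ 2 - U (q t + ε * h t)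
      + (γ / 2) * (leftCaputo a (1 / 2) q t + ε * leftCaputo a (1/2) h t) ^ 2))
    (F' := fun ε t => m * (deriv q t + ε * deriv h t) * deriv h t - deriv U (q t + ε * h t) * h t
      + γ * ((leftCaputo a (1 / 2) q t + ε * leftCaputo a (1/2) h t) * leftCaputo a (1/2) h t))
    (by intro ε; fun_prop) (by unfold Function.uncurry; fun_prop) ?_ a b 0
  · simp only [zero_mul, add_zero] at hD
    have h0 : frictionFunctional a b m γ U q = frictionFunctional a b m γ U (q + (0:ℝ) • h) := by simp
    have hD2 := hasDerivAt_iff_tendsto_slope.1 hD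
    refine tendsto_nhds_unique hD2 (hlim.congr' ?_)
    refine Eventually.of_forall fun ε => ?_
    beta_reduce
    rw [slope_def_field, h0, hF, hF, sub_zero]
  · intro ε t
    have l : ∀ x y : ℝ, HasDerivAt (fun ε : ℝ => x + ε * y) y ε := by
      intro x y
      simpa using ((hasDerivAt_id ε).mul_const y).const_add x
    have h1 := ((l (deriv q t) (deriv h t)).pow 2).const_mul ((1/2) * m)
    have h2 := ((hUd (q t + ε * h t)).hasDerivAt).comp ε (l (q t) (h t))
    have h3 := ((l (leftCaputo a (1 / 2) q t) (leftCaputo a (1/2) h t)).pow 2).const_mul (γ / 2)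
    refine ((h1.sub h2).add h3).congr_deriv ?_
    simp
    ring

theorem integrated_eq {a b m γ : ℝ} (hab : a < b) {U q : ℝ → ℝ} (hU : ContDiff ℝ 2 U)
    (hq : ContDiff ℝ 2 q) (hext : IsShExtremalFriction a b m γ U q) :
    ∃ C, ∀ t ∈ Set.Icc a b, m * deriv q t
      + γ * rightRLint b (1 - 1/2) (fun s => leftCaputo a (1 / 2) q s) t
      + (∫ u in a..t, deriv U (q u)) = C := by
  have hq' : Continuous (deriv q) := hq.continuous_deriv (by norm_num)
  have hU' : Continuous (deriv U) := hU.continuous_deriv (by norm_num)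
  have hqc := hq.continuous
  have hKe : leftCaputo a (1/2) q = fun t => (Real.Gamma (1 / 2))⁻¹ * abelT a (deriv q) t :=
      funext (caputo_eq hq' a)
  have hKc : Continuous (leftCaputo a (1/2) q) := by
    rw [hKe]
    exact continuous_const.mul (continuous_abelT hq' a)
  have hRe : rightRLint b (1 - 1/2) (fun s => leftCaputo a (1 / 2) q s) = fun s =>
      (Real.Gamma (1 / 2))⁻¹ * abelT (-b) (fun x => leftCaputo a (1 / 2) q (-x)) (-s) :=
    funext (rightRL_eq hKc b)
  have hRc : Continuous (rightRLint b (1 - 1/2) (fun s => leftCaputo a (1 / 2) q s)) := by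
    rw [hRe]
    exact continuous_const.mul ((continuous_abelT (by fun_prop) _).comp continuous_neg)
  have hVd : ∀ x, HasDerivAt (fun t => ∫ u in a..t, deriv U (q u)) (deriv U (q x)) x := fun x =>
      intervalIntegral.integral_hasDerivAt_right
        (Continuous.intervalIntegrable (by fun_prop) _ _)
        (Continuous.stronglyMeasurableAtFilter (by fun_prop) _ _) (by fun_prop)
  have hVc : Continuous (fun t => ∫ u in a..t, deriv U (q u)) :=
    continuous_iff_continuousAt.2 fun x => (hVd x).continuousAt
  apply dubois hab
  · fun_prop
  intro h hh ha hb
  have hv := first_variation hU hq hh (hext h hh ha hb)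
  have hh' : Continuous (deriv h) := hh.continuous_deriv (by norm_num)
  have hhc := hh.continuous
  have hhd : Differentiable ℝ h := hh.differentiable (by norm_num)
  have hLc : Continuous (leftCaputo a (1/2) h) := by
    rw [show leftCaputo a (1/2) h = fun t => (Real.Gamma (1 / 2))⁻¹ * abelT a (deriv h) t from
      funext (caputo_eq hh' a)]
    exact continuous_const.mul (continuous_abelT hh' a)
  have hfub : ∫ t in a..b, leftCaputo a (1 / 2) q t * leftCaputo a (1 / 2) h t
      = ∫ t in a..b, rightRLint b (1 - 1/2) (fun s => leftCaputo a (1 / 2) q s) t * deriv h t := by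
    have := abelT_fubini hab hKc hh'
    have e1 : (fun t => leftCaputo a (1 / 2) q t * leftCaputo a (1 / 2) h t) = fun t =>
        (Real.Gamma (1 / 2))⁻¹ * (leftCaputo a (1 / 2) q t * abelT a (deriv h) t) := by
      ext t; rw [caputo_eq hh']; ring
    have e2 : (fun t => rightRLint b (1 - 1/2) (fun s => leftCaputo a (1 / 2) q s) t * deriv h t)
        = fun t => (Real.Gamma (1 / 2))⁻¹ *
          (abelT (-b) (fun x => leftCaputo a (1 / 2) q (-x)) (-t) * deriv h t) := by
      rw [hRe]; ext t; ring
    rw [e1, e2, intervalIntegral.integral_const_mul, intervalIntegral.integral_const_mul, this]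
  have hibp := intervalIntegral.integral_mul_deriv_eq_deriv_mul (a := a) (b := b)
    (u := fun t => ∫ u in a..t, deriv U (q u)) (v := h) (u' := fun t => deriv U (q t)) (v' := deriv h)
    (fun x _ => hVd x) (fun x _ => (hhd x).hasDerivAt)
    (Continuous.intervalIntegrable (by fun_prop) _ _) (Continuous.intervalIntegrable (by fun_prop) _ _)
  rw [ha, hb, mul_zero, mul_zero, sub_zero, zero_sub] at hibp
  rw [intervalIntegral.integral_add (Continuous.intervalIntegrable (by fun_prop) _ _)
    (Continuous.intervalIntegrable (by fun_prop) _ _),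
    intervalIntegral.integral_sub (Continuous.intervalIntegrable (by fun_prop) _ _)
    (Continuous.intervalIntegrable (by fun_prop) _ _), intervalIntegral.integral_const_mul, hfub] at hv
  have e : (fun t => (m * deriv q t
      + γ * rightRLint b (1 - 1/2) (fun s => leftCaputo a (1 / 2) q s) t
      + (∫ u in a..t, deriv U (q u))) * deriv h t) = fun t => (m * deriv q t * deriv h t
      + γ * (rightRLint b (1 - 1/2) (fun s => leftCaputo a (1 / 2) q s) t * deriv h t))
      + (∫ u in a..t, deriv U (q u)) * deriv h t := by
    ext t; ring
  rw [e, intervalIntegral.integral_add (Continuous.intervalIntegrable (by fun_prop) _ _)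
    (Continuous.intervalIntegrable (by fun_prop) _ _),
    intervalIntegral.integral_add (Continuous.intervalIntegrable (by fun_prop) _ _)
    (Continuous.intervalIntegrable (by fun_prop) _ _), intervalIntegral.integral_const_mul, hibp]
  linarith

/-- Endpoint `b`. -/
theorem endpoint_b {a b c : ℝ} (hab : a < b) {K S : ℝ → ℝ} {k d : ℝ} (hKc : Continuous K)
    (hc : 0 < c)
    (hK : HasDerivAt K k b) (hS : HasDerivAt S d b)
    (h : ∀ s ∈ Set.Icc a b, c * abelT (-b) (fun x => K (-x)) (-s) = S s) :
    HasDerivAt (fun s => c * abelT (-b) (fun x => K (-x)) (-s)) d b := by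
  set N : ℝ → ℝ := fun s => ∫ u in (0:ℝ)..1, K (s + (b - s) * u ^ 2) with hN
  have form : ∀ s, c * abelT (-b) (fun x => K (-x)) (-s) = 2 * c * √(b - s) * N s := by
    intro s
    rw [abelT, show -s - -b = b - s by ring, hN]
    have : (fun u : ℝ => K (-(-s - (b - s) * u ^ 2))) = fun u => K (s + (b - s) * u ^ 2) := by
      ext u; congr 1; ring
    simp only [this]
    ring
  have hNc : Continuous N := by
    apply intervalIntegral.continuous_parametric_intervalIntegral_of_continuous'
    unfold Function.uncurry
    fun_prop
  have hNb : N b = K b := by simp [hN]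
  have hSb : S b = 0 := by
    rw [← h b ⟨hab.le, le_rfl⟩, form]; simp
  have hKb : K b = 0 := by
    have t1 : Tendsto (fun s => 2 * c * N s) (𝓝[<] b) (𝓝 (2 * c * N b)) :=
      (Continuous.tendsto (by fun_prop) b).mono_left nhdsWithin_le_nhds
    have t2 : Tendsto (fun s => slope S b s * (-√(b - s))) (𝓝[<] b) (𝓝 (d * (-√(b - b)))) := by
      refine Tendsto.mul ?_ ?_
      · exact (hasDerivAt_iff_tendsto_slope.1 hS).mono_left
          (nhdsWithin_mono b (fun x (hx : x < b) => hx.ne : Set.Iio b ⊆ {b}ᶜ))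
      · exact (Continuous.tendsto (by fun_prop) b).mono_left nhdsWithin_le_nhds
    have := tendsto_nhds_unique_of_eventuallyEq t1 t2 ?_
    · rw [hNb] at this
      simp at this
      exact this.resolve_left hc.ne'
    · filter_upwards [Ioo_mem_nhdsLT hab] with s hs
      have hr : 0 < b - s := by linarith [hs.2]
      have hrp := Real.sqrt_pos.2 hr
      have hrs := Real.sq_sqrt hr.le
      rw [slope_def_field, ← h s ⟨hs.1.le, hs.2.le⟩, hSb, form, sub_zero,
        show s - b = -(b - s) by ring]
      generalize √(b - s) = r at *
      rw [← hrs]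
      field_simp
  have h0 : HasDerivAt (fun s => c * abelT (-b) (fun x => K (-x)) (-s)) 0 b := by
    obtain ⟨M, hM⟩ := (hK.isBigO_sub).bound
    obtain ⟨δ, hδ, hball⟩ := Metric.eventually_nhds_iff.1 hM
    rw [hasDerivAt_iff_tendsto_slope]
    have tz : Tendsto (fun s => 2 * c * M * √(b - s)) (𝓝[≠] b) (𝓝 0) := by
      have : Tendsto (fun s => 2 * c * M * √(b - s)) (𝓝 b) (𝓝 (2 * c * M * √(b - b))) :=
        Continuous.tendsto (by fun_prop) b
      simp only [sub_self, Real.sqrt_zero, mul_zero] at this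
      exact this.mono_left nhdsWithin_le_nhds
    refine squeeze_zero_norm' ?_ tz
    filter_upwards [nhdsWithin_le_nhds (Metric.ball_mem_nhds b hδ), self_mem_nhdsWithin] with s hs hne
    have hne' : 0 < |s - b| := abs_pos.2 (sub_ne_zero.2 hne)
    rw [slope_def_field, form, form, sub_self, Real.sqrt_zero, mul_zero, zero_mul, sub_zero,
      norm_div, Real.norm_eq_abs (s - b), div_le_iff₀ hne', norm_mul,
      Real.norm_of_nonneg (by positivity)]
    have hNs : ‖N s‖ ≤ M * |s - b| := by
      have := intervalIntegral.norm_integral_le_of_norm_le_const (a := 0) (b := 1) (C := M * |s - b|)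
        (f := fun u : ℝ => K (s + (b - s) * u ^ 2)) ?_
      · simpa using this
      · intro u hu
        rw [Set.uIoc_of_le zero_le_one] at hu
        have hu2 : 0 ≤ 1 - u ^ 2 := by nlinarith [hu.1, hu.2]
        have hu3 : 1 - u ^ 2 ≤ 1 := by nlinarith [sq_nonneg u]
        have e : |s + (b - s) * u ^ 2 - b| = |s - b| * (1 - u ^ 2) := by
          rw [show s + (b - s) * u ^ 2 - b = (s - b) * (1 - u ^ 2) by ring, abs_mul, abs_of_nonneg hu2]
        have hle : |s + (b - s) * u ^ 2 - b| ≤ |s - b| := by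
          rw [e]; exact mul_le_of_le_one_right (abs_nonneg _) hu3
        have hd : dist (s + (b - s) * u ^ 2) b < δ := by
          rw [Real.dist_eq]; exact hle.trans_lt (by simpa [Real.dist_eq] using hs)
        have hb := hball hd
        rw [hKb, sub_zero, Real.norm_eq_abs (_ - b)] at hb
        have hM0 : 0 ≤ M := by
          by_contra hcon
          push Not at hcon
          have hd2 : dist s b < δ := hs
          have h7 := hball hd2
          rw [Real.norm_eq_abs (s - b)] at h7
          have := norm_nonneg (K s - K b)
          nlinarith
        exact hb.trans (mul_le_mul_of_nonneg_left hle hM0)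
    calc 2 * c * √(b - s) * ‖N s‖ ≤ 2 * c * √(b - s) * (M * |s - b|) := by gcongr
      _ = _ := by ring
  have : d = 0 := by
    have w1 := hS.hasDerivWithinAt (s := Set.Icc a b)
    have w2 : HasDerivWithinAt S 0 (Set.Icc a b) b :=
      (h0.hasDerivWithinAt (s := Set.Icc a b)).congr (fun s hs => (h s hs).symm)
        (h b ⟨hab.le, le_rfl⟩).symm
    exact (uniqueDiffOn_Icc hab b ⟨hab.le, le_rfl⟩).eq_deriv _ w1 w2
  rw [this]; exact h0

/-- Endpoint `a`. -/
theorem endpoint_a {a b c : ℝ} (hab : a < b) {g S : ℝ → ℝ} {d : ℝ} (hc : 0 < c)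
    (hg : ContDiff ℝ 1 g) (hS : HasDerivAt S d a)
    (h : ∀ s ∈ Set.Icc a b, c * abelT (-b) (fun x => c * abelT a g (-x)) (-s) = S s) :
    HasDerivAt (fun s => c * abelT (-b) (fun x => c * abelT a g (-x)) (-s)) d a := by
  have hgd : Differentiable ℝ g := hg.differentiable (by norm_num)
  have hg' : Continuous (deriv g) := hg.continuous_deriv (by norm_num)
  have hgc := hg.continuous
  set f : ℝ → ℝ := fun x => g x - g a with hf
  have hfc : Continuous f := by fun_prop
  have hfd : ∀ x, HasDerivAt f (deriv g x) x := fun x => (hgd x).hasDerivAt.sub_const _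
  have hE : ∀ t, HasDerivAt (abelT a f) (abelT a (deriv g) t) t := fun t =>
    hasDerivAt_abelT_of_zero hfd hg' (by simp [hf]) t
  have hfT := continuous_abelT hfc a
  have hg'T := continuous_abelT hg' a
  have hsplit : ∀ t, abelT a g t = abelT a f t + g a * (2 * √(t - a)) := by
    intro t
    have := abelT_add_mul hfc (continuous_const (y := (1:ℝ))) (g a) a t
    have e : (fun x => f x + g a * 1) = g := by ext x; simp [hf]
    rw [e] at this
    rw [this]
    simp [abelT]
  set RE : ℝ → ℝ := fun s => c * abelT (-b) (fun x => c * abelT a f (-x)) (-s) with hRE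
  have hR : ∀ s, c * abelT (-b) (fun x => c * abelT a g (-x)) (-s)
      = RE s + 2 * c ^ 2 * g a * abelT (-b) (fun x => √(-x - a)) (-s) := by
    intro s
    have e : (fun x => c * abelT a g (-x)) = fun x => c * abelT a f (-x) +
        (2 * c * g a) * √(-x - a) := by
      ext x; rw [hsplit]; ring
    rw [e, abelT_add_mul (by fun_prop) (by fun_prop)]
    simp only [hRE]; ring
  obtain ⟨D, hD⟩ : ∃ D, HasDerivAt RE D a := by
    have i1 : ∀ x, HasDerivAt (fun x => c * abelT a f (-x)) (c * (abelT a (deriv g) (-x) * -1)) x :=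
      fun x => ((hE (-x)).comp x (hasDerivAt_neg x)).const_mul c
    have i2 := hasDerivAt_abelT i1 (by fun_prop) (a := -b) (t := -a) (by linarith)
    exact ⟨_, (i2.comp a (hasDerivAt_neg a)).const_mul c⟩
  by_cases hp : g a = 0
  · have hR' : (fun s => c * abelT (-b) (fun x => c * abelT a g (-x)) (-s)) = RE := by
      ext s; rw [hR, hp]; ring
    rw [hR']
    have : D = d := by
      have w1 := hS.hasDerivWithinAt (s := Set.Icc a b)
      have w2 : HasDerivWithinAt S D (Set.Icc a b) a :=
        (hD.hasDerivWithinAt (s := Set.Icc a b)).congr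
          (fun s hs => by rw [← h s hs]; exact congrFun hR' s)
          (by rw [← h a ⟨le_rfl, hab.le⟩]; exact congrFun hR' a)
      exact (uniqueDiffOn_Icc hab a ⟨le_rfl, hab.le⟩).eq_deriv _ w2 w1
    rwa [← this]
  · exfalso
    have hk : 2 * c ^ 2 * g a ≠ 0 := by positivity
    refine no_deriv_abel hab ((hS.sub hD).div_const (2 * c ^ 2 * g a)) ?_
    intro s hs
    simp only [Pi.sub_apply]
    rw [← h s hs, hR]
    field_simp
    ring

/-- equation of motion for the linear friction Lagrangian:
`m q̈ − γ _tD_b^{1/2}(^C_aD_·^{1/2} q) = −U'(q)`. -/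
theorem friction_equation_of_motion
    {a b m γ : ℝ} (hab : a < b) (hm : 0 < m) (hγ : 0 < γ)
    (U : ℝ → ℝ) (hU : ContDiff ℝ 2 U)
    (q : ℝ → ℝ) (hq : ContDiff ℝ 2 q)
    (hext : IsShExtremalFriction a b m γ U q) :
    ∀ t ∈ Set.Icc a b,
      m * deriv (deriv q) t
          - γ * rightRLderiv b (1 / 2) (fun s => leftCaputo a (1 / 2) q s) t
        = -deriv U (q t) := by
  obtain ⟨C, hC⟩ := integrated_eq hab hU hq hext
  have hq' : Continuous (deriv q) := hq.continuous_deriv (by norm_num)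
  have hq1 : ContDiff ℝ 1 (deriv q) := by
    have : ContDiff ℝ (1 + 1) q := hq
    exact (contDiff_succ_iff_deriv.1 this).2.2
  have hq'd : Differentiable ℝ (deriv q) := hq1.differentiable (by norm_num)
  have hq'' : Continuous (deriv (deriv q)) := hq1.continuous_deriv (by norm_num)
  have hU' : Continuous (deriv U) := hU.continuous_deriv (by norm_num)
  have hqc := hq.continuous
  set c := (Real.Gamma (1 / 2))⁻¹ with hc
  have hcpos : 0 < c := inv_pos.2 (Real.Gamma_pos_of_pos (by norm_num))
  have hKe : leftCaputo a (1/2) q = fun t => c * abelT a (deriv q) t := funext (caputo_eq hq' a)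
  have hTc := continuous_abelT hq' a
  have hKc : Continuous (leftCaputo a (1/2) q) := by rw [hKe]; fun_prop
  have hRe : (fun s => rightRLint b (1 - 1/2) (fun s => leftCaputo a (1 / 2) q s) s) = fun s =>
      c * abelT (-b) (fun x => c * abelT a (deriv q) (-x)) (-s) := by
    ext s
    rw [rightRL_eq hKc b, hKe]
  have hVd : ∀ x, HasDerivAt (fun t => ∫ u in a..t, deriv U (q u)) (deriv U (q x)) x := fun x =>
      intervalIntegral.integral_hasDerivAt_right
        (Continuous.intervalIntegrable (by fun_prop) _ _)
        (Continuous.stronglyMeasurableAtFilter (by fun_prop) _ _) (by fun_prop)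
  have hSd : ∀ t, HasDerivAt (fun t => (C - m * deriv q t - ∫ u in a..t, deriv U (q u)) / γ)
      ((-(m * deriv (deriv q) t) - deriv U (q t)) / γ) t := fun t =>
    ((((hq'd t).hasDerivAt.const_mul m).const_sub C).sub (hVd t)).div_const γ
  have hRS : ∀ s ∈ Set.Icc a b, c * abelT (-b) (fun x => c * abelT a (deriv q) (-x)) (-s)
      = (C - m * deriv q s - ∫ u in a..s, deriv U (q u)) / γ := by
    intro s hs
    have h1 := hC s hs
    have h2 := congrFun hRe s
    rw [← h2, eq_div_iff hγ.ne']
    linarith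
  intro t ht
  have main : HasDerivAt (fun s => c * abelT (-b) (fun x => c * abelT a (deriv q) (-x)) (-s))
      ((-(m * deriv (deriv q) t) - deriv U (q t)) / γ) t := by
    rcases ht.1.eq_or_lt with h1 | h1
    · subst h1
      exact endpoint_a hab hcpos hq1 (hSd _) hRS
    rcases ht.2.eq_or_lt with h2 | h2
    · subst h2
      exact endpoint_b hab (K := fun x => c * abelT a (deriv q) x) (by fun_prop) hcpos
        ((hasDerivAt_abelT (fun x => (hq'd x).hasDerivAt) hq'' hab).const_mul c) (hSd _) hRS
    · refine (hSd t).congr_of_eventuallyEq ?_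
      filter_upwards [Icc_mem_nhds h1 h2] with s hs using hRS s hs
  rw [rightRLderiv, hRe, main.deriv]
  field_simp
  ring
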